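/- For all integers g, ℓ, h ≥ 1 with h ≤ g + ℓ, and every n ≥ 1, the pair (g exc_ℓ, g den_h) is equidistributed with (rdes, rmaj) over S_n where r = g + ℓ − 1; that is, for all integers a, b, the number of σ ∈ S_n with g exc_ℓ(σ) = a and g den_h(σ) = b equals the number of σ ∈ S_n with rdes(σ) = a and rmaj(σ) = b. (Theorem 1.4: (g exc_ℓ, g den_h) is (g+ℓ−1)-Euler–Mahonian for all 1 ≤ h ≤ g+ℓ.) -/

import Mathlib

open Finset

namespace PaperStmt

/-- 1-based position of `i : Fin n` (so positions run through `1,…,n`). -/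
def pos1 {n : ℕ} (i : Fin n) : ℕ := (i : ℕ) + 1

/-- 1-based value `σ_i` of the permutation `σ` at position `i`. -/
def val1 {n : ℕ} (σ : Equiv.Perm (Fin n)) (i : Fin n) : ℕ := (σ i : ℕ) + 1

/-- The number of inversions of the subsequence of `σ` consisting of the letters at the
positions satisfying `P`: pairs of positions `i < j`, both satisfying `P`,
with `σ_i > σ_j`. -/
def invOn {n : ℕ} (σ : Equiv.Perm (Fin n)) (P : Fin n → Prop) [DecidablePred P] : ℕ :=
  (univ.filter fun p : Fin n × Fin n =>
    p.1 < p.2 ∧ P p.1 ∧ P p.2 ∧ val1 σ p.2 < val1 σ p.1).card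

/-- `inv σ`: the number of inversions of `σ`. -/
def inv {n : ℕ} (σ : Equiv.Perm (Fin n)) : ℕ := invOn σ (fun _ => True)

/-- `Exc(σ)`: the set of excedances, i.e. positions `i` with `σ_i > i`. -/
def excSet {n : ℕ} (σ : Equiv.Perm (Fin n)) : Finset (Fin n) :=
  univ.filter fun i => pos1 i < val1 σ i

/-- `exc σ`: the number of excedances. -/
def exc {n : ℕ} (σ : Equiv.Perm (Fin n)) : ℕ := (excSet σ).card

/-- `exc_r(σ)`: the number of `r`-level excedances, i.e. positions `i ≥ r` with `σ_i > i`. -/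
def excLvl {n : ℕ} (r : ℕ) (σ : Equiv.Perm (Fin n)) : ℕ :=
  (univ.filter fun i => pos1 i < val1 σ i ∧ r ≤ pos1 i).card

/-- Denert's statistic `den σ`. -/
def den {n : ℕ} (σ : Equiv.Perm (Fin n)) : ℕ :=
  ((univ.filter fun i => pos1 i < val1 σ i).sum pos1)
  + invOn σ (fun i => pos1 i < val1 σ i)
  + invOn σ (fun i => ¬ pos1 i < val1 σ i)

/-- The `h`-level Denert statistic `den_h(σ)`. -/
def denLvl {n : ℕ} (h : ℕ) (σ : Equiv.Perm (Fin n)) : ℕ :=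
  ((univ.filter fun i => pos1 i < val1 σ i ∧ h ≤ val1 σ i).sum pos1)
  + invOn σ (fun i => pos1 i < val1 σ i ∧ h ≤ val1 σ i)
  + invOn σ (fun i => ¬ (pos1 i < val1 σ i ∧ h ≤ val1 σ i))

/-- `g exc_ℓ(σ)`: the number of `g`-gap `ℓ`-level excedances,
i.e. positions `i ≥ ℓ` with `σ_i ≥ i + g`. -/
def gexc {n : ℕ} (g l : ℕ) (σ : Equiv.Perm (Fin n)) : ℕ :=
  (univ.filter fun i => pos1 i + g ≤ val1 σ i ∧ l ≤ pos1 i).card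

/-- `gExclp_h(σ)`: the set of `g`-gap `h`-level excedance-letter positions,
i.e. positions `i` with `σ_i ≥ i + g` and `σ_i ≥ h`. -/
def gExclpSet {n : ℕ} (g h : ℕ) (σ : Equiv.Perm (Fin n)) : Finset (Fin n) :=
  univ.filter fun i => pos1 i + g ≤ val1 σ i ∧ h ≤ val1 σ i

/-- The `g`-gap `h`-level Denert statistic `g den_h(σ)`. -/
def gden {n : ℕ} (g h : ℕ) (σ : Equiv.Perm (Fin n)) : ℕ :=
  ((univ.filter fun i => pos1 i + g ≤ val1 σ i ∧ h ≤ val1 σ i).sum fun i => pos1 i + g - 1)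
  + invOn σ (fun i => pos1 i + g ≤ val1 σ i ∧ h ≤ val1 σ i)
  + invOn σ (fun i => ¬ (pos1 i + g ≤ val1 σ i ∧ h ≤ val1 σ i))

/-- `rexc σ`: the number of `r`-excedances, i.e. positions `i` with `σ_i ≥ i + r`. -/
def rexc {n : ℕ} (r : ℕ) (σ : Equiv.Perm (Fin n)) : ℕ :=
  (univ.filter fun i => pos1 i + r ≤ val1 σ i).card

/-- The `r`-Denert statistic `rden σ`. -/
def rden {n : ℕ} (r : ℕ) (σ : Equiv.Perm (Fin n)) : ℕ :=
  ((univ.filter fun i => pos1 i + r ≤ val1 σ i).sum fun i => pos1 i + r - 1)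
  + invOn σ (fun i => pos1 i + r ≤ val1 σ i)
  + invOn σ (fun i => ¬ pos1 i + r ≤ val1 σ i)

/-- Pairs `(i, i+1)` of adjacent positions forming an `r`-descent: `σ_i ≥ σ_{i+1} + r`. -/
def rdesPairs {n : ℕ} (r : ℕ) (σ : Equiv.Perm (Fin n)) : Finset (Fin n × Fin n) :=
  univ.filter fun p => pos1 p.2 = pos1 p.1 + 1 ∧ val1 σ p.2 + r ≤ val1 σ p.1

/-- `rdes σ`: the number of `r`-descents. -/
def rdes {n : ℕ} (r : ℕ) (σ : Equiv.Perm (Fin n)) : ℕ := (rdesPairs r σ).card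

/-- `rmaj σ`: the sum of the `r`-descents plus the number of pairs `i < j`
with `σ_j < σ_i < σ_j + r`. -/
def rmaj {n : ℕ} (r : ℕ) (σ : Equiv.Perm (Fin n)) : ℕ :=
  ((rdesPairs r σ).sum fun p => pos1 p.1)
  + (univ.filter fun p : Fin n × Fin n =>
      p.1 < p.2 ∧ val1 σ p.2 < val1 σ p.1 ∧ val1 σ p.1 < val1 σ p.2 + r).card

/-- `des σ`: the number of descents, i.e. positions `i ∈ [n-1]` with `σ_i > σ_{i+1}`. -/
def des {n : ℕ} (σ : Equiv.Perm (Fin n)) : ℕ :=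
  (univ.filter fun p : Fin n × Fin n =>
    pos1 p.2 = pos1 p.1 + 1 ∧ val1 σ p.2 < val1 σ p.1).card

/-- `maj σ`: the major index, i.e. the sum of the descents of `σ`. -/
def maj {n : ℕ} (σ : Equiv.Perm (Fin n)) : ℕ :=
  ((univ.filter fun p : Fin n × Fin n =>
    pos1 p.2 = pos1 p.1 + 1 ∧ val1 σ p.2 < val1 σ p.1).sum fun p => pos1 p.1)

/-- Insert the letter `c` at position `i` of `τ`, shifting the other positions and letters. -/
def insertAt {n : ℕ} (i c : Fin (n + 1)) (τ : Equiv.Perm (Fin n)) : Equiv.Perm (Fin (n + 1)) :=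
  (finSuccEquiv' i).trans ((Equiv.optionCongr τ).trans (finSuccEquiv' c).symm)

lemma insertAt_self {n : ℕ} (i c : Fin (n + 1)) (τ : Equiv.Perm (Fin n)) :
    insertAt i c τ i = c := by
  simp [insertAt]

lemma insertAt_succAbove {n : ℕ} (i c : Fin (n + 1)) (τ : Equiv.Perm (Fin n)) (j : Fin n) :
    insertAt i c τ (i.succAbove j) = c.succAbove (τ j) := by
  simp [insertAt]

lemma insertAt_injective {n : ℕ} (i c : Fin (n + 1)) : Function.Injective (insertAt i c) := by
  intro τ τ' h
  ext j : 1
  have := congrArg (fun σ : Equiv.Perm (Fin (n + 1)) => σ (i.succAbove j)) h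
  simpa [insertAt_succAbove] using this

lemma sum_perm_insertAt_letter {n : ℕ} {R : Type*} [AddCommMonoid R] (i : Fin (n + 1))
    (f : Equiv.Perm (Fin (n + 1)) → R) :
    ∑ σ, f σ = ∑ c, ∑ τ, f (insertAt i c τ) := by
  rw [← Fintype.sum_prod_type' (f := fun c τ => f (insertAt i c τ))]
  symm
  refine Fintype.sum_bijective (fun p : Fin (n + 1) × Equiv.Perm (Fin n) => insertAt i p.1 p.2)
    ?_ _ _ fun _ => rfl
  rw [Fintype.bijective_iff_injective_and_card]
  refine ⟨?_, by simp [Fintype.card_perm, Nat.factorial_succ]⟩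
  rintro ⟨c, τ⟩ ⟨c', τ'⟩ h
  obtain rfl : c = c' := by
    simpa [insertAt_self] using congrArg (fun σ : Equiv.Perm (Fin (n + 1)) => σ i) h
  exact congrArg _ (insertAt_injective i c h)

lemma sum_perm_insertAt_position {n : ℕ} {R : Type*} [AddCommMonoid R] (c : Fin (n + 1))
    (f : Equiv.Perm (Fin (n + 1)) → R) :
    ∑ σ, f σ = ∑ i, ∑ τ, f (insertAt i c τ) := by
  rw [← Fintype.sum_prod_type' (f := fun i τ => f (insertAt i c τ))]
  symm
  refine Fintype.sum_bijective (fun p : Fin (n + 1) × Equiv.Perm (Fin n) => insertAt p.1 c p.2)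
    ?_ _ _ fun _ => rfl
  rw [Fintype.bijective_iff_injective_and_card]
  refine ⟨?_, by simp [Fintype.card_perm, Nat.factorial_succ]⟩
  rintro ⟨i, τ⟩ ⟨i', τ'⟩ h
  obtain rfl : i = i' := by
    have h' : insertAt i c τ i = insertAt i' c τ' i' := by simp [insertAt_self]
    simp only at h
    rw [h] at h'
    exact (insertAt i' c τ').injective h'
  exact congrArg _ (insertAt_injective i c h)

lemma val_succAbove {n : ℕ} (i : Fin (n + 1)) (j : Fin n) :
    ((i.succAbove j : Fin (n + 1)) : ℕ) = if (j : ℕ) < i then (j : ℕ) else j + 1 := by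
  unfold Fin.succAbove
  simp only [Fin.lt_def, Fin.val_castSucc]
  split_ifs <;> simp

lemma card_pairs_succAbove {n : ℕ} (i : Fin (n + 1)) (Q : Fin (n + 1) → Fin (n + 1) → Prop)
    [∀ a b, Decidable (Q a b)] (hQ : ¬ Q i i) :
    (univ.filter fun p : Fin (n + 1) × Fin (n + 1) => Q p.1 p.2).card
      = (univ.filter fun p : Fin n × Fin n => Q (i.succAbove p.1) (i.succAbove p.2)).card
        + ((univ.filter fun j : Fin n => Q i (i.succAbove j)).card
        + (univ.filter fun j : Fin n => Q (i.succAbove j) i).card) := by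
  simp only [card_filter]
  rw [Fintype.sum_prod_type, Fintype.sum_prod_type, Fin.sum_univ_succAbove _ i]
  simp only [Fin.sum_univ_succAbove _ i, hQ, if_false, sum_add_distrib]
  ring

/-- The `q`-integer `1 + q + ⋯ + q ^ (n - 1)`. -/
def qint {R : Type*} [CommRing R] (q : R) (n : ℕ) : R := ∑ i ∈ range n, q ^ i

lemma qint_zero {R : Type*} [CommRing R] (q : R) : qint q 0 = 0 := by simp [qint]

lemma qint_succ {R : Type*} [CommRing R] (q : R) (n : ℕ) :
    qint q (n + 1) = qint q n + q ^ n := by simp [qint, sum_range_succ]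

lemma one_sub_mul_qint {R : Type*} [CommRing R] (q : R) (n : ℕ) :
    (1 - q) * qint q n = 1 - q ^ n := by
  rw [qint, mul_neg_geom_sum]

/-- The `q`-factorial. -/
def qfact {R : Type*} [CommRing R] (q : R) : ℕ → R
  | 0 => 1
  | n + 1 => qint q (n + 1) * qfact q n

lemma sum_fin_pow_lt {R : Type*} [CommRing R] (q : R) {n y : ℕ} (hy : y ≤ n) :
    (∑ c : Fin n, if (c : ℕ) < y then q ^ (c : ℕ) else 0) = qint q y := by
  rw [Fin.sum_univ_eq_sum_range (fun c => if c < y then q ^ c else 0) n, ← sum_filter, qint]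
  congr 1
  ext a
  simp
  omega

/-- The number of letters (`none`) preceding the `k`-th position (`some w`) of a path. -/
def thr {R : Type*} : List (Option R) → ℕ → ℕ
  | [], _ => 0
  | none :: s, k => thr s k + 1
  | some _ :: _, 0 => 0
  | some _ :: s, k + 1 => thr s k

/-- The weight of the `k`-th position of a path. -/
def wgt {R : Type*} [CommRing R] : List (Option R) → ℕ → R
  | [], _ => 1
  | none :: s, k => wgt s k
  | some w :: _, 0 => w
  | some _ :: s, k + 1 => wgt s k

/-- The number of positions of a path. -/
def posCount {R : Type*} : List (Option R) → ℕ
  | [] => 0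
  | none :: s => posCount s
  | some _ :: s => posCount s + 1

/-- The number of letters of a path. -/
def letCount {R : Type*} : List (Option R) → ℕ
  | [] => 0
  | none :: s => letCount s + 1
  | some _ :: s => letCount s

/-- Processing a path with `x` open positions and `y` open letters, the first `x` positions are
excedances and position `x + k` is one when its letter is at least `y + thr s k`. -/
abbrev IsExc {R : Type*} (s : List (Option R)) (x y : ℕ) {m : ℕ} (σ : Equiv.Perm (Fin m))
    (i : Fin m) : Prop :=
  (i : ℕ) < x ∨ y + thr s (i - x) ≤ σ i

/-- The weight of a completion of a path. -/
def pathWeight {R : Type*} [CommRing R] (q : R) (s : List (Option R)) (x y : ℕ) {m : ℕ}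
    (σ : Equiv.Perm (Fin m)) : R :=
  (∏ i : Fin m, if x ≤ i ∧ y + thr s (i - x) ≤ σ i then wgt s (i - x) else 1)
    * q ^ (invOn σ (fun i => IsExc s x y σ i) + invOn σ (fun i => ¬ IsExc s x y σ i))

/-- The weighted sum of all completions of a path. -/
def pathSum {R : Type*} [CommRing R] (q : R) (s : List (Option R)) (m x y : ℕ) : R :=
  ∑ σ : Equiv.Perm (Fin m), if ∀ i : Fin m, (i : ℕ) < x → y ≤ σ i then pathWeight q s x y σ else 0

/-- The action of a position of weight `w` on functions of the numbers of open positions and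
open letters. -/
def posOp {R : Type*} [CommRing R] (q w : R) (f : ℕ → ℕ → R) (x y : ℕ) : R :=
  w * f (x + 1) y + qint q y * f x (y - 1)

/-- The action of a letter. -/
def letOp {R : Type*} [CommRing R] (q : R) (f : ℕ → ℕ → R) (x y : ℕ) : R :=
  f x (y + 1) + qint q x * f (x - 1) y

/-- The action of a path. -/
def transfer {R : Type*} [CommRing R] (q : R) :
    List (Option R) → (ℕ → ℕ → R) → ℕ → ℕ → R
  | [], f => f
  | none :: s, f => letOp q (transfer q s f)
  | some w :: s, f => posOp q w (transfer q s f)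

/-- The indicator function of having no open position. -/
def noOpen {R : Type*} [CommRing R] (x _y : ℕ) : R := if x = 0 then 1 else 0

lemma invOn_congr {m : ℕ} (σ : Equiv.Perm (Fin m)) (P Q : Fin m → Prop) [DecidablePred P]
    [DecidablePred Q] (h : ∀ i, P i ↔ Q i) : invOn σ P = invOn σ Q := by
  unfold invOn
  congr 1
  ext p
  simp [h]

lemma invOn_insertAt {n : ℕ} (i c : Fin (n + 1)) (τ : Equiv.Perm (Fin n))
    (P : Fin (n + 1) → Prop) [DecidablePred P] :
    invOn (insertAt i c τ) P = invOn τ (fun j => P (i.succAbove j))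
      + (univ.filter fun j : Fin n => P i ∧ P (i.succAbove j) ∧
          ((j : ℕ) < i ∧ (c : ℕ) ≤ τ j ∨ (i : ℕ) ≤ j ∧ (τ j : ℕ) < c)).card := by
  unfold invOn
  rw [card_pairs_succAbove i
    (fun a b => a < b ∧ P a ∧ P b ∧ val1 (insertAt i c τ) b < val1 (insertAt i c τ) a) (by simp)]
  congr 1
  · congr 1
    ext p
    simp [val1, insertAt_succAbove]
  · rw [← card_union_of_disjoint]
    · congr 1
      ext j
      simp only [val1, insertAt_succAbove, insertAt_self, Fin.lt_def, val_succAbove, mem_union,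
        mem_filter, mem_univ, true_and]
      by_cases h1 : (j : ℕ) < i <;> by_cases h2 : (τ j : ℕ) < c <;>
        simp only [h1, h2, if_true, if_false] <;> constructor <;> intro h <;> grind
    · rw [disjoint_filter]
      intro j _ h1 h2
      exact lt_asymm h1.1 h2.1

lemma pathWeight_some_of_le {R : Type*} [CommRing R] (q w : R) (s : List (Option R)) {m x y : ℕ}
    (hx : x < m) (σ : Equiv.Perm (Fin m)) (h : y ≤ σ ⟨x, hx⟩) :
    pathWeight q (some w :: s) x y σ = w * pathWeight q s (x + 1) y σ := by
  have key : ∀ i : Fin m, IsExc (some w :: s) x y σ i ↔ IsExc s (x + 1) y σ i := by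
    intro i
    rcases lt_trichotomy (i : ℕ) x with h1 | h1 | h1
    · simp only [IsExc]; omega
    · have : i = ⟨x, hx⟩ := Fin.ext h1
      subst this
      simp [IsExc, thr, h]
    · obtain ⟨k, hk⟩ := Nat.exists_eq_add_of_lt h1
      have e1 : (i : ℕ) - x = k + 1 := by omega
      have e2 : (i : ℕ) - (x + 1) = k := by omega
      simp only [IsExc, e1, e2, thr]
      omega
  unfold pathWeight
  rw [invOn_congr σ _ _ key, invOn_congr σ _ _ (fun i => not_congr (key i)), ← mul_assoc]
  congr 1
  rw [← mul_prod_erase univ _ (mem_univ (⟨x, hx⟩ : Fin m)),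
    ← mul_prod_erase univ (fun i : Fin m => if x + 1 ≤ (i : ℕ) ∧ _ then _ else _)
      (mem_univ (⟨x, hx⟩ : Fin m))]
  simp only [le_refl, Nat.sub_self, thr, wgt, add_zero, h, and_self, if_true, Nat.not_succ_le_self,
    false_and, if_false, one_mul]
  congr 1
  refine prod_congr rfl fun i hi => ?_
  have hne : (i : ℕ) ≠ x := fun e => (mem_erase.1 hi).1 (Fin.ext e)
  rcases lt_or_gt_of_ne hne with h1 | h1
  · rw [if_neg (by omega), if_neg (by omega)]
  · obtain ⟨k, hk⟩ := Nat.exists_eq_add_of_lt h1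
    have e1 : (i : ℕ) - x = k + 1 := by omega
    have e2 : (i : ℕ) - (x + 1) = k := by omega
    simp only [e1, e2, thr, wgt]
    refine if_congr ?_ rfl rfl
    omega

lemma pathWeight_none {R : Type*} [CommRing R] (q : R) (s : List (Option R)) {m x y : ℕ}
    (σ : Equiv.Perm (Fin m)) :
    pathWeight q (none :: s) x y σ = pathWeight q s x (y + 1) σ := by
  have e : ∀ k z, y + (thr s k + 1) ≤ z ↔ y + 1 + thr s k ≤ z := by intros; omega
  unfold pathWeight
  simp only [IsExc, thr, wgt, e]

lemma isExc_insertAt_position {R : Type*} (w : R) (s : List (Option R)) {n x y : ℕ}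
    (hx : x < n + 1) (c : Fin (n + 1)) (hc : (c : ℕ) < y) (τ : Equiv.Perm (Fin n)) (j : Fin n) :
    IsExc (some w :: s) x y (insertAt ⟨x, hx⟩ c τ) ((⟨x, hx⟩ : Fin (n + 1)).succAbove j) ↔
      IsExc s x (y - 1) τ j := by
  simp only [IsExc, insertAt_succAbove, val_succAbove]
  by_cases h1 : (j : ℕ) < x
  · simp [h1]
  · have e1 : (j : ℕ) + 1 - x = (j - x) + 1 := by omega
    simp only [h1, if_false, e1, thr, false_or, show ¬ (j : ℕ) + 1 < x by omega]
    split_ifs <;> omega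

lemma pathWeight_insertAt_position {R : Type*} [CommRing R] (q w : R) (s : List (Option R))
    {n x y : ℕ} (hx : x < n + 1) (c : Fin (n + 1)) (hc : (c : ℕ) < y) (τ : Equiv.Perm (Fin n))
    (hτ : ∀ i : Fin n, (i : ℕ) < x → y - 1 ≤ τ i) :
    pathWeight q (some w :: s) x y (insertAt ⟨x, hx⟩ c τ)
      = q ^ (c : ℕ) * pathWeight q s x (y - 1) τ := by
  have key := isExc_insertAt_position w s hx c hc τ
  have hself : ¬ IsExc (some w :: s) x y (insertAt ⟨x, hx⟩ c τ) ⟨x, hx⟩ := by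
    simp [IsExc, insertAt_self, thr, hc]
  unfold pathWeight
  rw [invOn_insertAt, invOn_insertAt, invOn_congr τ _ _ key,
    invOn_congr τ _ _ (fun i => not_congr (key i))]
  have hprod : (∏ i : Fin (n + 1), if x ≤ (i : ℕ) ∧
        y + thr (some w :: s) (i - x) ≤ (insertAt ⟨x, hx⟩ c τ i : ℕ)
        then wgt (some w :: s) (i - x) else 1)
      = ∏ i : Fin n, if x ≤ (i : ℕ) ∧ y - 1 + thr s (i - x) ≤ τ i then wgt s (i - x) else 1 := by
    rw [Fin.prod_univ_succAbove _ ⟨x, hx⟩]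
    rw [if_neg (by simp [insertAt_self, thr, hc]), one_mul]
    refine prod_congr rfl fun j _ => ?_
    simp only [insertAt_succAbove, val_succAbove]
    by_cases h1 : (j : ℕ) < x
    · simp only [h1, if_true]
      rw [if_neg (by omega), if_neg (by omega)]
    · have e1 : (j : ℕ) + 1 - x = (j - x) + 1 := by omega
      simp only [h1, if_false, e1, thr, wgt]
      refine if_congr ?_ rfl rfl
      split_ifs <;> omega
  have hcard1 : (univ.filter fun j : Fin n =>
      IsExc (some w :: s) x y (insertAt ⟨x, hx⟩ c τ) ⟨x, hx⟩ ∧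
      IsExc (some w :: s) x y (insertAt ⟨x, hx⟩ c τ) ((⟨x, hx⟩ : Fin (n + 1)).succAbove j) ∧
      ((j : ℕ) < x ∧ (c : ℕ) ≤ τ j ∨ x ≤ (j : ℕ) ∧ (τ j : ℕ) < c)).card = 0 := by
    rw [card_eq_zero, filter_eq_empty_iff]
    exact fun j _ h => hself h.1
  have hcard2 : (univ.filter fun j : Fin n =>
      ¬ IsExc (some w :: s) x y (insertAt ⟨x, hx⟩ c τ) ⟨x, hx⟩ ∧
      ¬ IsExc (some w :: s) x y (insertAt ⟨x, hx⟩ c τ) ((⟨x, hx⟩ : Fin (n + 1)).succAbove j) ∧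
      ((j : ℕ) < x ∧ (c : ℕ) ≤ τ j ∨ x ≤ (j : ℕ) ∧ (τ j : ℕ) < c)).card = c := by
    have : (univ.filter fun j : Fin n => (τ j : ℕ) < c).card = c := by
      rw [← card_map τ.toEmbedding]
      have : (univ.filter fun j : Fin n => (τ j : ℕ) < c).map τ.toEmbedding
          = univ.filter fun j : Fin n => (j : ℕ) < c := by
        ext a
        simp only [mem_map_equiv, mem_filter, mem_univ, true_and, Equiv.apply_symm_apply]
      rw [this, Fin.card_filter_val_lt]
      omega
    rw [← this]
    congr 1
    ext j
    simp only [mem_filter, mem_univ, true_and, key, hself, not_false_iff]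
    simp only [IsExc]
    have := hτ j
    constructor
    · rintro ⟨h1, h2⟩
      omega
    · intro h
      by_cases h1 : (j : ℕ) < x
      · have := this h1
        omega
      · omega
  simp only [] at hcard1 hcard2 ⊢
  rw [hprod, hcard1, hcard2, add_zero, ← add_assoc, pow_add]
  ring

lemma forall_insertAt_position {n x y : ℕ} (hx : x < n + 1) (c : Fin (n + 1)) (hc : (c : ℕ) < y)
    (τ : Equiv.Perm (Fin n)) :
    (∀ i : Fin (n + 1), (i : ℕ) < x → y ≤ insertAt ⟨x, hx⟩ c τ i) ↔
      ∀ i : Fin n, (i : ℕ) < x → y - 1 ≤ τ i := by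
  rw [Fin.forall_iff_succAbove (⟨x, hx⟩ : Fin (n + 1))]
  simp only [lt_irrefl, false_imp_iff, true_and, insertAt_succAbove, val_succAbove]
  refine forall_congr' fun j => ?_
  by_cases h1 : (j : ℕ) < x
  · simp only [h1, if_true, true_imp_iff]
    split_ifs <;> omega
  · simp only [h1, if_false, false_imp_iff]
    simp only [iff_true]
    omega

lemma pathSum_some {R : Type*} [CommRing R] (q w : R) (s : List (Option R)) {n x y : ℕ}
    (hx : x < n + 1) (hy : y ≤ n + 1) :
    pathSum q (some w :: s) (n + 1) x y
      = w * pathSum q s (n + 1) (x + 1) y + qint q y * pathSum q s n x (y - 1) := by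
  have hsplit : pathSum q (some w :: s) (n + 1) x y
      = (∑ σ : Equiv.Perm (Fin (n + 1)), if y ≤ (σ ⟨x, hx⟩ : ℕ) then
          (if ∀ i : Fin (n + 1), (i : ℕ) < x → y ≤ σ i then
            pathWeight q (some w :: s) x y σ else 0) else 0)
        + ∑ σ : Equiv.Perm (Fin (n + 1)), if (σ ⟨x, hx⟩ : ℕ) < y then
          (if ∀ i : Fin (n + 1), (i : ℕ) < x → y ≤ σ i then
            pathWeight q (some w :: s) x y σ else 0) else 0 := by
    rw [← sum_add_distrib]
    refine sum_congr rfl fun σ _ => ?_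
    by_cases h : y ≤ (σ ⟨x, hx⟩ : ℕ)
    · rw [if_pos h, if_neg (not_lt.2 h), add_zero]
    · rw [if_neg h, if_pos (not_le.1 h), zero_add]
  rw [hsplit]
  congr 1
  · rw [pathSum, mul_sum]
    refine sum_congr rfl fun σ _ => ?_
    rw [← ite_and, mul_ite, mul_zero]
    by_cases h : y ≤ (σ ⟨x, hx⟩ : ℕ)
    · rw [pathWeight_some_of_le q w s hx σ h]
      refine if_congr ?_ rfl rfl
      constructor
      · rintro ⟨-, h2⟩ i hi
        rcases Nat.lt_succ_iff_lt_or_eq.1 hi with h3 | h3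
        · exact h2 i h3
        · rwa [show i = ⟨x, hx⟩ from Fin.ext h3]
      · exact fun h2 => ⟨h, fun i hi => h2 i (Nat.lt_succ_of_lt hi)⟩
    · rw [if_neg (fun h2 => h h2.1), if_neg (fun h2 => h (h2 ⟨x, hx⟩ (Nat.lt_succ_self x)))]
  · rw [sum_perm_insertAt_letter ⟨x, hx⟩]
    simp only [insertAt_self]
    rw [← sum_fin_pow_lt q hy, sum_mul]
    refine sum_congr rfl fun c _ => ?_
    by_cases hc : (c : ℕ) < y
    · simp only [hc, if_true, pathSum, mul_sum, forall_insertAt_position hx c hc]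
      refine sum_congr rfl fun τ _ => ?_
      split_ifs with h
      · exact pathWeight_insertAt_position q w s hx c hc τ h
      · simp
    · simp [hc]

lemma pathWeight_insertAt_letter {R : Type*} [CommRing R] (q : R) (s : List (Option R))
    {n x y : ℕ} (hy : y < n + 1) (p : Fin (n + 1)) (hp : (p : ℕ) < x) (τ : Equiv.Perm (Fin n))
    (hτ : ∀ i : Fin n, (i : ℕ) < x - 1 → y ≤ τ i) :
    pathWeight q (none :: s) x y (insertAt p ⟨y, hy⟩ τ)
      = q ^ (p : ℕ) * pathWeight q s (x - 1) y τ := by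
  have key : ∀ j, IsExc (none :: s) x y (insertAt p ⟨y, hy⟩ τ) (p.succAbove j) ↔
      IsExc s (x - 1) y τ j := by
    intro j
    simp only [IsExc, insertAt_succAbove, val_succAbove, thr]
    by_cases h1 : (j : ℕ) < x - 1
    · simp only [h1, true_or, iff_true]
      left
      split_ifs <;> omega
    · have e1 : ¬ (j : ℕ) < p := by omega
      have e2 : (j : ℕ) + 1 - x = j - (x - 1) := by omega
      simp only [h1, e1, if_false, e2, false_or, show ¬ (j : ℕ) + 1 < x by omega]
      split_ifs <;> omega
  have hself : IsExc (none :: s) x y (insertAt p ⟨y, hy⟩ τ) p := Or.inl hp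
  unfold pathWeight
  rw [invOn_insertAt, invOn_insertAt, invOn_congr τ _ _ key,
    invOn_congr τ _ _ (fun i => not_congr (key i))]
  have hprod : (∏ i : Fin (n + 1), if x ≤ (i : ℕ) ∧
        y + thr (none :: s) (i - x) ≤ (insertAt p ⟨y, hy⟩ τ i : ℕ)
        then wgt (none :: s) (i - x) else 1)
      = ∏ i : Fin n, if x - 1 ≤ (i : ℕ) ∧ y + thr s (i - (x - 1)) ≤ τ i
        then wgt s (i - (x - 1)) else 1 := by
    rw [Fin.prod_univ_succAbove _ p, if_neg (by omega), one_mul]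
    refine prod_congr rfl fun j _ => ?_
    simp only [insertAt_succAbove, val_succAbove]
    by_cases h1 : (j : ℕ) < x - 1
    · rw [if_neg (by split_ifs <;> omega), if_neg (by omega)]
    · have e1 : ¬ (j : ℕ) < p := by omega
      have e2 : (j : ℕ) + 1 - x = j - (x - 1) := by omega
      simp only [e1, if_false, e2, thr, wgt]
      refine if_congr ?_ rfl rfl
      split_ifs <;> omega
  have hcard1 : (univ.filter fun j : Fin n =>
      IsExc (none :: s) x y (insertAt p ⟨y, hy⟩ τ) p ∧
      IsExc (none :: s) x y (insertAt p ⟨y, hy⟩ τ) (p.succAbove j) ∧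
      ((j : ℕ) < p ∧ y ≤ (τ j : ℕ) ∨ (p : ℕ) ≤ j ∧ (τ j : ℕ) < y)).card = p := by
    have : (univ.filter fun j : Fin n => (j : ℕ) < p).card = p := by
      rw [Fin.card_filter_val_lt]
      omega
    refine Eq.trans ?_ this
    congr 1
    ext j
    simp only [mem_filter, mem_univ, true_and, key, hself]
    simp only [IsExc]
    have := hτ j
    constructor
    · rintro ⟨h1, h2⟩
      by_cases h3 : (j : ℕ) < x - 1
      · have := this h3
        omega
      · omega
    · intro h
      have := this (by omega)
      omega
  have hcard2 : (univ.filter fun j : Fin n =>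
      ¬ IsExc (none :: s) x y (insertAt p ⟨y, hy⟩ τ) p ∧
      ¬ IsExc (none :: s) x y (insertAt p ⟨y, hy⟩ τ) (p.succAbove j) ∧
      ((j : ℕ) < p ∧ y ≤ (τ j : ℕ) ∨ (p : ℕ) ≤ j ∧ (τ j : ℕ) < y)).card = 0 := by
    rw [card_eq_zero, filter_eq_empty_iff]
    exact fun j _ h => h.1 hself
  simp only [] at hcard1 hcard2 ⊢
  rw [hprod, hcard1, hcard2, add_zero, add_right_comm, pow_add]
  ring

lemma forall_insertAt_letter {n x y : ℕ} (hy : y < n + 1) (p : Fin (n + 1)) (hp : (p : ℕ) < x)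
    (τ : Equiv.Perm (Fin n)) :
    (∀ i : Fin (n + 1), (i : ℕ) < x → y ≤ insertAt p ⟨y, hy⟩ τ i) ↔
      ∀ i : Fin n, (i : ℕ) < x - 1 → y ≤ τ i := by
  rw [Fin.forall_iff_succAbove p]
  simp only [insertAt_self, le_refl, imp_true_iff, true_and, insertAt_succAbove, val_succAbove]
  refine forall_congr' fun j => ?_
  split_ifs <;> constructor <;> intro h1 h2 <;> omega

lemma pathSum_none {R : Type*} [CommRing R] (q : R) (s : List (Option R)) {n x y : ℕ}
    (hx : x ≤ n + 1) (hy : y < n + 1) :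
    pathSum q (none :: s) (n + 1) x y
      = pathSum q s (n + 1) x (y + 1) + qint q x * pathSum q s n (x - 1) y := by
  have hsplit : pathSum q (none :: s) (n + 1) x y
      = (∑ σ : Equiv.Perm (Fin (n + 1)), if x ≤ (σ.symm ⟨y, hy⟩ : ℕ) then
          (if ∀ i : Fin (n + 1), (i : ℕ) < x → y ≤ σ i then
            pathWeight q (none :: s) x y σ else 0) else 0)
        + ∑ σ : Equiv.Perm (Fin (n + 1)), if (σ.symm ⟨y, hy⟩ : ℕ) < x then
          (if ∀ i : Fin (n + 1), (i : ℕ) < x → y ≤ σ i then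
            pathWeight q (none :: s) x y σ else 0) else 0 := by
    rw [← sum_add_distrib]
    refine sum_congr rfl fun σ _ => ?_
    by_cases h : x ≤ (σ.symm ⟨y, hy⟩ : ℕ)
    · rw [if_pos h, if_neg (not_lt.2 h), add_zero]
    · rw [if_neg h, if_pos (not_le.1 h), zero_add]
  rw [hsplit]
  congr 1
  · rw [pathSum]
    refine sum_congr rfl fun σ _ => ?_
    rw [← ite_and, pathWeight_none]
    refine if_congr ?_ rfl rfl
    constructor
    · rintro ⟨h1, h2⟩ i hi
      refine lt_of_le_of_ne (h2 i hi) fun e => ?_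
      have : σ.symm ⟨y, hy⟩ = i := by
        rw [Equiv.symm_apply_eq]
        exact Fin.ext e
      rw [this] at h1
      omega
    · refine fun h => ⟨?_, fun i hi => (Nat.lt_of_succ_le (h i hi)).le⟩
      by_contra! h1
      simpa using h _ h1
  · have hsymm : ∀ (i : Fin (n + 1)) (τ : Equiv.Perm (Fin n)),
        (insertAt i ⟨y, hy⟩ τ).symm ⟨y, hy⟩ = i := by
      intro i τ
      rw [Equiv.symm_apply_eq, insertAt_self]
    rw [sum_perm_insertAt_position ⟨y, hy⟩]
    simp only [hsymm]
    rw [← sum_fin_pow_lt q hx, sum_mul]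
    refine sum_congr rfl fun p _ => ?_
    by_cases hp : (p : ℕ) < x
    · simp only [hp, if_true, pathSum, mul_sum, forall_insertAt_letter hy p hp]
      refine sum_congr rfl fun τ _ => ?_
      split_ifs with h
      · exact pathWeight_insertAt_letter q s hy p hp τ h
      · simp
    · simp [hp]

lemma pathSum_eq_transfer {R : Type*} [CommRing R] (q : R) (s : List (Option R)) :
    ∀ m x y : ℕ, m = x + posCount s → m = y + letCount s →
      pathSum q s m x y = transfer q s noOpen x y := by
  induction s with
  | nil =>
    intro m x y hx hy
    simp only [posCount, letCount, add_zero] at hx hy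
    subst hx hy
    cases m with
    | zero => simp [pathSum, pathWeight, transfer, noOpen, invOn]
    | succ m =>
      simp only [pathSum, transfer, noOpen, Nat.succ_ne_zero, if_false]
      refine sum_eq_zero fun σ _ => if_neg fun h => ?_
      have := h 0 (Nat.succ_pos m)
      have := (σ 0).isLt
      omega
  | cons a s ih =>
    intro m x y hx hy
    cases a with
    | none =>
      simp only [posCount, letCount] at hx hy
      obtain ⟨n, rfl⟩ : ∃ n, m = n + 1 := ⟨y + letCount s, by omega⟩
      rw [pathSum_none q s (by omega) (by omega), transfer, letOp,
        ih (n + 1) x (y + 1) (by omega) (by omega)]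
      cases x with
      | zero => simp [qint_zero]
      | succ x => rw [ih n (x + 1 - 1) y (by omega) (by omega)]
    | some w =>
      simp only [posCount, letCount] at hx hy
      obtain ⟨n, rfl⟩ : ∃ n, m = n + 1 := ⟨x + posCount s, by omega⟩
      rw [pathSum_some q w s (by omega) (by omega), transfer, posOp,
        ih (n + 1) (x + 1) y (by omega) (by omega)]
      cases y with
      | zero => simp [qint_zero]
      | succ y => rw [ih n x (y + 1 - 1) (by omega) (by omega)]

lemma posOp_congr {R : Type*} [CommRing R] (q w : R) {d : ℕ} {f f' : ℕ → ℕ → R}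
    (h : ∀ x, f x (x + d) = f' x (x + d)) (x : ℕ) :
    posOp q w f x (x + (d + 1)) = posOp q w f' x (x + (d + 1)) := by
  have h1 := h (x + 1)
  rw [add_right_comm x 1 d] at h1
  simp only [posOp, ← add_assoc, add_tsub_cancel_right, h, h1]

lemma letOp_congr {R : Type*} [CommRing R] (q : R) {d : ℕ} {f f' : ℕ → ℕ → R}
    (h : ∀ x, f x (x + (d + 1)) = f' x (x + (d + 1))) (x : ℕ) :
    letOp q f x (x + d) = letOp q f' x (x + d) := by
  have h1 := h x
  rw [← add_assoc] at h1
  cases x with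
  | zero => simp only [letOp, qint_zero, zero_mul, h1]
  | succ x =>
    have h2 := h x
    rw [← add_assoc, add_right_comm] at h2
    simp only [letOp, h1, add_tsub_cancel_right, h2]

lemma posOp_comm {R : Type*} [CommRing R] (q w w' : R) (f : ℕ → ℕ → R) :
    posOp q w (posOp q w' f) = posOp q w' (posOp q w f) := by
  funext x y
  simp only [posOp]
  ring

lemma letOp_posOp_comm {R : Type*} [CommRing R] (q : R) (f : ℕ → ℕ → R) (x d : ℕ) :
    letOp q (posOp q (q ^ d) f) x (x + d) = posOp q (q ^ d) (letOp q f) x (x + d) := by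
  rcases Nat.eq_zero_or_pos (x + d) with h | h
  · obtain ⟨rfl, rfl⟩ : x = 0 ∧ d = 0 := by omega
    simp [letOp, posOp, qint]
  · obtain ⟨e, he⟩ : ∃ e, x + d = e + 1 := ⟨x + d - 1, by omega⟩
    have h1 : qint q (x + d + 1) = qint q (x + d) + q ^ x * q ^ d := by
      rw [qint_succ, pow_add]
    rw [he] at h1
    cases x with
    | zero =>
      simp only [letOp, posOp, he, h1, qint_succ q 0, add_tsub_cancel_right, qint_zero]
      ring
    | succ x =>
      simp only [letOp, posOp, he, h1, qint_succ q (x + 1), add_tsub_cancel_right]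
      ring

lemma transfer_append {R : Type*} [CommRing R] (q : R) (s s' : List (Option R))
    (f : ℕ → ℕ → R) : transfer q (s ++ s') f = transfer q s (transfer q s' f) := by
  induction s with
  | nil => rfl
  | cons a s ih => cases a <;> simp [transfer, ih]

lemma transfer_replicate_none {R : Type*} [CommRing R] (q : R) (c : ℕ) (f : ℕ → ℕ → R) (y : ℕ) :
    transfer q (List.replicate c none) f 0 y = f 0 (y + c) := by
  induction c generalizing y with
  | zero => rfl
  | succ c ih =>
    simp only [List.replicate_succ, transfer, letOp, qint_zero, zero_mul, add_zero, ih]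
    congr 1
    ring

/-- The consecutive positions of weights `u a, …, u (a + j - 1)`. -/
def posBlock {R : Type*} (u : ℕ → R) (a j : ℕ) : List (Option R) :=
  (List.range' a j).map fun m => some (u m)

lemma posBlock_succ {R : Type*} (u : ℕ → R) (a j : ℕ) :
    posBlock u a (j + 1) = posBlock u a j ++ [some (u (a + j))] := by
  simp [posBlock, List.range'_concat]

lemma posBlock_succ' {R : Type*} (u : ℕ → R) (a j : ℕ) :
    posBlock u a (j + 1) = some (u a) :: posBlock u (a + 1) j := by
  simp [posBlock, List.range'_succ]

lemma transfer_posBlock_posOp {R : Type*} [CommRing R] (q w : R) (u : ℕ → R) (a j : ℕ)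
    (f : ℕ → ℕ → R) :
    transfer q (posBlock u a j) (posOp q w f) = posOp q w (transfer q (posBlock u a j) f) := by
  induction j generalizing a with
  | zero => rfl
  | succ j ih => rw [posBlock_succ', transfer, transfer, ih, posOp_comm]

lemma posBlock_congr {R : Type*} (u u' : ℕ → R) (a j : ℕ)
    (h : ∀ m < a + j, u m = u' m) : posBlock u a j = posBlock u' a j := by
  refine List.map_congr_left fun m hm => ?_
  rw [h m (by simp at hm; omega)]

lemma transfer_posBlock_letOp {R : Type*} [CommRing R] (q : R) (d j : ℕ) (f : ℕ → ℕ → R)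
    (x : ℕ) :
    transfer q (posBlock (fun m => q ^ m) (d + 1) j) (letOp q f) x (x + (d + j))
      = letOp q (transfer q (posBlock (fun m => q ^ m) (d + 1) j) f) x (x + (d + j)) := by
  induction j generalizing x with
  | zero => rfl
  | succ j ih =>
    rw [posBlock_succ, transfer_append, transfer_append]
    simp only [transfer]
    rw [transfer_posBlock_posOp, transfer_posBlock_posOp, ← add_assoc d j 1, posOp_congr q _ ih,
      add_right_comm d 1 j, letOp_posOp_comm]

lemma transfer_posBlock_noOpen {R : Type*} [CommRing R] (q : R) (u : ℕ → R) (a j x : ℕ) :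
    transfer q (posBlock u a j) noOpen x (x + j) = qfact q j * noOpen x (x + j) := by
  induction j generalizing a x with
  | zero => simp [posBlock, transfer, qfact]
  | succ j ih =>
    have h1 := ih (a + 1) (x + 1)
    rw [add_right_comm] at h1
    simp only [posBlock_succ', transfer, posOp, ← add_assoc, add_tsub_cancel_right, h1, ih]
    by_cases hx : x = 0
    · subst hx
      simp [noOpen, qfact]
    · simp [noOpen, hx]

/-- The end of a path: `k` times a letter followed by a position, then `d` positions, the
positions having weights `u m, u (m + 1), …`. -/
def zigzag {R : Type*} (u : ℕ → R) (d : ℕ) : ℕ → ℕ → List (Option R)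
  | 0, m => posBlock u m d
  | k + 1, m => none :: some (u m) :: zigzag u d k (m + 1)

/-- The path of the statistics with gap `d + 1` and level `d + 1 + j` in size `d + j + k`. -/
def gapPath {R : Type*} (u : ℕ → R) (d j k : ℕ) : List (Option R) :=
  List.replicate (d + j) none ++ (posBlock u (d + 1) j ++ zigzag u d k (d + 1 + j))

lemma transfer_gapPath_succ {R : Type*} [CommRing R] (q : R) (u : ℕ → R) (d j k : ℕ)
    (hu : ∀ m < d + 1 + j, u m = q ^ m) :
    transfer q (gapPath u d j (k + 1)) noOpen 0 0
      = transfer q (gapPath u d (j + 1) k) noOpen 0 0 := by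
  simp only [gapPath, transfer_append, transfer_replicate_none, zigzag, transfer]
  rw [posBlock_succ, transfer_append, posBlock_congr u _ _ _ hu,
    transfer_posBlock_letOp]
  simp only [letOp, qint_zero, zero_mul, add_zero, transfer]
  rfl

lemma transfer_gapPath_add {R : Type*} [CommRing R] (q : R) (u : ℕ → R) (d j k i : ℕ)
    (hu : ∀ m < d + j + i, u m = q ^ m) :
    transfer q (gapPath u d j (k + i)) noOpen 0 0
      = transfer q (gapPath u d (j + i) k) noOpen 0 0 := by
  induction i generalizing j with
  | zero => rfl
  | succ i ih =>
    rw [← add_assoc k, transfer_gapPath_succ q u d j (k + i) (fun m hm => hu m (by omega)),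
      ih (j + 1) (fun m hm => hu m (by omega)), add_right_comm j, add_assoc]

lemma transfer_gapPath_zero {R : Type*} [CommRing R] (q : R) (u : ℕ → R) (d j : ℕ) :
    transfer q (gapPath u d j 0) noOpen 0 0 = qfact q (d + j) := by
  have : posBlock u (d + 1) j ++ posBlock u (d + 1 + j) d = posBlock u (d + 1) (d + j) := by
    rw [posBlock, posBlock, ← List.map_append, posBlock, List.range'_append_1, add_comm j]
  rw [gapPath, transfer_append, transfer_replicate_none, zigzag, this,
    transfer_posBlock_noOpen q u (d + 1) (d + j) 0]
  simp [noOpen]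

/-- The transfer function of the path of `r`-excedances. -/
def eulerMahonian {R : Type*} [CommRing R] (q t : R) (r : ℕ) : ℕ → ℕ → ℕ → ℕ → R
  | 0, _ => fun x y => qfact q r * noOpen x y
  | k + 1, m => posOp q (t * q ^ m) (letOp q (eulerMahonian q t r k (m + 1)))

lemma transfer_posBlock_zigzag {R : Type*} [CommRing R] (q t : R) (u : ℕ → R) (d j k m x : ℕ)
    (hu : ∀ i, m ≤ i → u i = t * q ^ i) :
    transfer q (posBlock (fun m => q ^ m) (d + 1) j)
        (posOp q (u m) (transfer q (zigzag u d k (m + 1)) noOpen)) x (x + (d + j + 1))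
      = eulerMahonian q t (d + j + 1) k m x (x + (d + j + 1)) := by
  induction k generalizing m x with
  | zero =>
    rw [zigzag, eulerMahonian]
    have h1 : posOp q (u m) (transfer q (posBlock u (m + 1) d) noOpen)
        = transfer q (posBlock u m (d + 1)) noOpen := by rw [posBlock_succ']; rfl
    rw [h1]
    have h2 : ∀ j x, transfer q (posBlock (fun m => q ^ m) (d + 1) j)
        (transfer q (posBlock u m (d + 1)) noOpen) x (x + (d + j + 1))
        = qfact q (d + j + 1) * noOpen x (x + (d + j + 1)) := by
      intro j
      induction j with
      | zero => exact transfer_posBlock_noOpen q u m (d + 1)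
      | succ j ih =>
        intro x
        rw [posBlock_succ, transfer_append]
        simp only [transfer]
        rw [transfer_posBlock_posOp, ← add_assoc d j 1, posOp_congr q _
          (f' := fun x y => qfact q (d + j + 1) * noOpen x y) ih]
        have e : x + (d + j + 1 + 1) - 1 = x + (d + j + 1) := by omega
        simp only [posOp, e]
        by_cases hx : x = 0
        · subst hx
          simp only [noOpen, qfact, zero_add]
          simp
        · simp [noOpen, hx]
    exact h2 j x
  | succ k ih =>
    rw [eulerMahonian, transfer_posBlock_posOp, hu m le_rfl]
    refine posOp_congr q _ (fun z => ?_) x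
    simp only [zigzag, transfer]
    rw [transfer_posBlock_letOp]
    exact letOp_congr q (fun z => ih (m + 1) z (fun i hi => hu i (by omega))) z

lemma transfer_gapPath {R : Type*} [CommRing R] (q t : R) (u : ℕ → R) (d j k : ℕ)
    (hu : ∀ m < d + j + 1, u m = q ^ m) (hu' : ∀ m, d + j + 1 ≤ m → u m = t * q ^ m) :
    transfer q (gapPath u d (j + 1) k) noOpen 0 0
      = eulerMahonian q t (d + j + 1) k (d + j + 1) 0 (d + j + 1) := by
  have := transfer_posBlock_zigzag q t u d j k (d + j + 1) 0 hu'
  rw [zero_add] at this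
  rw [← this, gapPath, transfer_append, transfer_replicate_none, transfer_append, posBlock_succ,
    transfer_append, posBlock_congr u _ _ _ (fun m hm => hu m (by omega)),
    zero_add, ← add_assoc d j 1, add_right_comm d 1 j, add_right_comm d 1 (j + 1),
    ← add_assoc d j 1]
  rfl

/-- The operator intertwining the shifts of `eulerMahonian`. -/
def shiftOp {R : Type*} [CommRing R] (q t : R) (m : ℕ) (f : ℕ → ℕ → R) (x y : ℕ) : R :=
  t * q ^ m * (1 - q) * f (x + 1) (y + 1) + (1 - t * q ^ (m + 1 + x)) * f x y

lemma shiftOp_posOp_letOp {R : Type*} [CommRing R] (q t : R) (m r x : ℕ) (f : ℕ → ℕ → R) :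
    shiftOp q t m (posOp q (t * q ^ (m + 1)) (letOp q f)) x (x + (r + 1))
      = posOp q (t * q ^ m) (letOp q (shiftOp q t (m + 1) f)) x (x + (r + 1)) := by
  have h1 : (1 - q) * qint q (x + r + 1) = 1 - q ^ x * q ^ r * q := by
    rw [one_sub_mul_qint]; ring
  cases x with
  | zero =>
    have hr := one_sub_mul_qint q r
    simp only [shiftOp, posOp, letOp, ← add_assoc, add_tsub_cancel_right, qint_succ, qint_zero]
    simp only [pow_add, pow_zero, pow_one, zero_add]
    generalize qint q r = A at *
    linear_combination t * q ^ m * (1 - q) * (f 1 (r + 1 + 1) + f 0 (r + 1)) * hr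
  | succ x =>
    have e : qint q (x + 1 + r + 1 + 1) = qint q (x + 1 + r + 1) + q ^ x * q ^ r * q ^ 2 := by
      rw [qint_succ]; ring
    simp only [shiftOp, posOp, letOp, ← add_assoc, add_tsub_cancel_right, e, qint_succ q (x + 1),
      qint_succ q (x + 1 + 1)]
    generalize qint q (x + 1 + r + 1) = A at *
    generalize qint q (x + 1) = B at *
    generalize f (x + 1 + 1 + 1) (x + 1 + r + 1 + 1 + 1) = f3 at *
    generalize f (x + 1 + 1) (x + 1 + r + 1 + 1) = f2 at *
    generalize f (x + 1) (x + 1 + r + 1) = f1 at *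
    generalize f x (x + 1 + r) = f0 at *
    simp only [pow_add, pow_one] at *
    linear_combination t * q ^ m * (1 - q) * (f2 + (B + q ^ x * q) * f1) * h1

lemma shiftOp_eulerMahonian {R : Type*} [CommRing R] (q t : R) (r k m x : ℕ) :
    shiftOp q t m (eulerMahonian q t (r + 1) k (m + 1)) x (x + (r + 1))
      = (1 - t * q ^ (m + 1 + k)) * eulerMahonian q t (r + 1) k m x (x + (r + 1)) := by
  induction k generalizing m x with
  | zero =>
    by_cases hx : x = 0
    · simp [shiftOp, eulerMahonian, noOpen, hx]
    · simp [shiftOp, eulerMahonian, noOpen, hx]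
  | succ k ih =>
    have h1 : ∀ z, letOp q (shiftOp q t (m + 1) (eulerMahonian q t (r + 1) k (m + 1 + 1))) z (z + r)
        = letOp q (fun x y => (1 - t * q ^ (m + 1 + 1 + k))
            * eulerMahonian q t (r + 1) k (m + 1) x y) z (z + r) :=
      letOp_congr q (ih (m + 1))
    simp only [eulerMahonian]
    rw [shiftOp_posOp_letOp, posOp_congr q _ h1]
    simp only [posOp, letOp]
    rw [add_right_comm (m + 1) 1 k, ← add_assoc (m + 1) k 1]
    ring

lemma eulerMahonian_mul {R : Type*} [CommRing R] (q t : R) (r k m : ℕ) :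
    eulerMahonian q (t * q) r k m = eulerMahonian q t r k (m + 1) := by
  induction k generalizing m with
  | zero => rfl
  | succ k ih =>
    rw [eulerMahonian, eulerMahonian, ih, pow_succ', mul_assoc]

lemma eulerMahonian_succ {R : Type*} [CommRing R] (q t : R) (r k : ℕ) :
    (1 - q) * eulerMahonian q t (r + 1) (k + 1) (r + 1) 0 (r + 1)
      = (1 - t * q ^ (r + 1 + 1 + k)) * eulerMahonian q t (r + 1) k (r + 1) 0 (r + 1)
        - q ^ (r + 1) * (1 - t) * eulerMahonian q (t * q) (r + 1) k (r + 1) 0 (r + 1) := by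
  have h1 := shiftOp_eulerMahonian q t r k (r + 1) 0
  have h2 := one_sub_mul_qint q (r + 1)
  have h3 := one_sub_mul_qint q 1
  rw [zero_add] at h1
  rw [← h1, eulerMahonian_mul, eulerMahonian]
  simp only [posOp, letOp, shiftOp, zero_add, qint_zero, add_tsub_cancel_right, zero_mul, add_zero,
    Nat.sub_self] at h2 h3 ⊢
  linear_combination eulerMahonian q t (r + 1) k (r + 1 + 1) 0 (r + 1) * (h2 + t * q ^ (r + 1) * h3)

lemma thr_replicate_none_append {R : Type*} (c : ℕ) (s : List (Option R)) (i : ℕ) :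
    thr (List.replicate c none ++ s) i = c + thr s i := by
  induction c with
  | zero => simp
  | succ c ih => rw [List.replicate_succ, List.cons_append, thr, ih, add_right_comm]

lemma wgt_replicate_none_append {R : Type*} [CommRing R] (c : ℕ) (s : List (Option R)) (i : ℕ) :
    wgt (List.replicate c none ++ s) i = wgt s i := by
  induction c with
  | zero => simp
  | succ c ih => rw [List.replicate_succ, List.cons_append, wgt, ih]

lemma thr_posBlock_append {R : Type*} (u : ℕ → R) (a j : ℕ) (s : List (Option R)) (i : ℕ) :
    thr (posBlock u a j ++ s) i = if i < j then 0 else thr s (i - j) := by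
  induction j generalizing a i with
  | zero => simp [posBlock]
  | succ j ih => cases i <;> simp [posBlock_succ', thr, ih]

lemma wgt_posBlock_append {R : Type*} [CommRing R] (u : ℕ → R) (a j : ℕ) (s : List (Option R))
    (i : ℕ) : wgt (posBlock u a j ++ s) i = if i < j then u (a + i) else wgt s (i - j) := by
  induction j generalizing a i with
  | zero => simp [posBlock]
  | succ j ih => cases i <;> simp [posBlock_succ', wgt, ih, add_assoc, add_comm 1]

lemma thr_zigzag {R : Type*} (u : ℕ → R) (d k m i : ℕ) (hi : i < k + d) :
    thr (zigzag u d k m) i = min (i + 1) k := by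
  induction k generalizing m i with
  | zero =>
    have := thr_posBlock_append u m d [] i
    rw [List.append_nil, if_pos (by omega)] at this
    simp [zigzag, this]
  | succ k ih =>
    cases i with
    | zero => simp [zigzag, thr]
    | succ i => rw [zigzag, thr, thr, ih (m + 1) i (by omega)]; omega

lemma wgt_zigzag {R : Type*} [CommRing R] (u : ℕ → R) (d k m i : ℕ) (hi : i < k + d) :
    wgt (zigzag u d k m) i = u (m + i) := by
  induction k generalizing m i with
  | zero =>
    have := wgt_posBlock_append u m d [] i
    rwa [List.append_nil, if_pos (by omega)] at this
  | succ k ih =>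
    cases i with
    | zero => simp [zigzag, wgt]
    | succ i => rw [zigzag, wgt, wgt, ih (m + 1) i (by omega), add_assoc, add_comm 1]

lemma posCount_append {R : Type*} (s s' : List (Option R)) :
    posCount (s ++ s') = posCount s + posCount s' := by
  induction s with
  | nil => simp [posCount]
  | cons a s ih => cases a <;> simp [posCount, ih, add_right_comm]

lemma letCount_append {R : Type*} (s s' : List (Option R)) :
    letCount (s ++ s') = letCount s + letCount s' := by
  induction s with
  | nil => simp [letCount]
  | cons a s ih => cases a <;> simp [letCount, ih, add_right_comm]

lemma posCount_replicate_none {R : Type*} (c : ℕ) :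
    posCount (List.replicate c (none : Option R)) = 0 := by
  induction c with
  | zero => rfl
  | succ c ih => rw [List.replicate_succ, posCount, ih]

lemma letCount_replicate_none {R : Type*} (c : ℕ) :
    letCount (List.replicate c (none : Option R)) = c := by
  induction c with
  | zero => rfl
  | succ c ih => rw [List.replicate_succ, letCount, ih]

lemma posCount_posBlock {R : Type*} (u : ℕ → R) (a j : ℕ) : posCount (posBlock u a j) = j := by
  induction j generalizing a with
  | zero => rfl
  | succ j ih => rw [posBlock_succ', posCount, ih]

lemma letCount_posBlock {R : Type*} (u : ℕ → R) (a j : ℕ) : letCount (posBlock u a j) = 0 := by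
  induction j generalizing a with
  | zero => rfl
  | succ j ih => rw [posBlock_succ', letCount, ih]

lemma posCount_zigzag {R : Type*} (u : ℕ → R) (d k m : ℕ) :
    posCount (zigzag u d k m) = k + d := by
  induction k generalizing m with
  | zero => rw [zigzag, posCount_posBlock, zero_add]
  | succ k ih => rw [zigzag, posCount, posCount, ih, add_right_comm]

lemma letCount_zigzag {R : Type*} (u : ℕ → R) (d k m : ℕ) :
    letCount (zigzag u d k m) = k := by
  induction k generalizing m with
  | zero => rw [zigzag, letCount_posBlock]
  | succ k ih => rw [zigzag, letCount, letCount, ih]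

/-- The weight of a position is `q ^ m`, with an additional factor `t` from `m = r` on. -/
def excWeight {R : Type*} [CommRing R] (q t : R) (r m : ℕ) : R :=
  if m < r then q ^ m else t * q ^ m

lemma pow_gexc_mul_pow_gden {R : Type*} [CommRing R] (q t : R) {g l h n : ℕ} (hl : 1 ≤ l)
    (hhgl : h ≤ g + l) (s : List (Option R))
    (hthr : ∀ a < n, ∀ c < n, thr s a ≤ c ↔ a + g ≤ c ∧ h ≤ c + 1)
    (hwgt : ∀ a, a + g < n → wgt s a = excWeight q t (g + l - 1) (a + g))
    (σ : Equiv.Perm (Fin n)) :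
    t ^ gexc g l σ * q ^ gden g h σ = pathWeight q s 0 0 σ := by
  have key : ∀ i : Fin n, IsExc s 0 0 σ i ↔ pos1 i + g ≤ val1 σ i ∧ h ≤ val1 σ i := by
    intro i
    simp only [IsExc, Nat.not_lt_zero, false_or, zero_add, Nat.sub_zero, hthr _ i.2 _ (σ i).2,
      pos1, val1]
    omega
  have hprod : t ^ gexc g l σ
      * q ^ (∑ i with pos1 i + g ≤ val1 σ i ∧ h ≤ val1 σ i, (pos1 i + g - 1))
      = ∏ i : Fin n, if 0 ≤ (i : ℕ) ∧ 0 + thr s (i - 0) ≤ σ i then wgt s (i - 0) else 1 := by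
    rw [gexc, ← prod_const, prod_filter, ← prod_pow_eq_pow_sum, prod_filter, ← prod_mul_distrib]
    refine prod_congr rfl fun i _ => ?_
    have hi := key i
    have hi' := hwgt i
    have hlt := (σ i).2
    simp only [IsExc, Nat.not_lt_zero, false_or, zero_add, Nat.sub_zero] at hi
    have hpos : pos1 i = i + 1 := rfl
    have hval : val1 σ i = σ i + 1 := rfl
    simp only [Nat.zero_le, true_and, Nat.sub_zero, zero_add, hi, excWeight] at hi' ⊢
    by_cases h1 : pos1 i + g ≤ val1 σ i ∧ h ≤ val1 σ i
    · rw [if_pos h1, if_pos h1, hi' (by omega)]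
      by_cases h2 : l ≤ pos1 i
      · rw [if_pos ⟨h1.1, h2⟩, if_neg (by omega)]
        congr 2
        omega
      · rw [if_neg (fun h => h2 h.2), if_pos (by omega), one_mul]
        congr 1
        omega
    · rw [if_neg h1, if_neg h1, if_neg (by omega), one_mul]
  unfold pathWeight gden
  rw [invOn_congr σ _ _ key, invOn_congr σ _ _ (fun i => not_congr (key i)), ← hprod, add_assoc,
    pow_add, mul_assoc]

lemma sum_gexc_gden_eq_transfer {R : Type*} [CommRing R] (q t : R) {g l h n d j k : ℕ}
    (hl : 1 ≤ l) (hhgl : h ≤ g + l) (hn : n = d + j + k)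
    (hd : ∀ a < n, ∀ c < n, d + j + (if a < j then 0 else min (a - j + 1) k) ≤ c
      ↔ a + g ≤ c ∧ h ≤ c + 1)
    (hg : n < g ∨ g = d + 1) :
    ∑ σ : Equiv.Perm (Fin n), t ^ gexc g l σ * q ^ gden g h σ
      = transfer q (gapPath (excWeight q t (g + l - 1)) d j k) noOpen 0 0 := by
  have hp : posCount (gapPath (excWeight q t (g + l - 1)) d j k) = n := by
    rw [gapPath, posCount_append, posCount_append, posCount_replicate_none, posCount_posBlock,
      posCount_zigzag]
    omega
  have hq : letCount (gapPath (excWeight q t (g + l - 1)) d j k) = n := by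
    rw [gapPath, letCount_append, letCount_append, letCount_replicate_none, letCount_posBlock,
      letCount_zigzag]
    omega
  rw [← pathSum_eq_transfer q _ n 0 0 (by omega) (by omega), pathSum]
  refine sum_congr rfl fun σ _ => ?_
  rw [if_pos (fun i hi => absurd hi (Nat.not_lt_zero _))]
  refine pow_gexc_mul_pow_gden q t hl hhgl _ (fun a ha c hc => ?_) (fun a ha => ?_) σ
  · rw [← hd a ha c hc, gapPath, thr_replicate_none_append, thr_posBlock_append]
    split_ifs with h1
    · rfl
    · rw [thr_zigzag _ _ _ _ _ (by omega)]
  · rw [gapPath, wgt_replicate_none_append, wgt_posBlock_append]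
    split_ifs with h1
    · congr 1
      omega
    · rw [wgt_zigzag _ _ _ _ _ (by omega)]
      congr 1
      omega

lemma exists_gapPath {R : Type*} [CommRing R] (q t : R) {g l h n : ℕ} (hg : 1 ≤ g) (hl : 1 ≤ l)
    (hhgl : h ≤ g + l) (hgn : g ≤ n) :
    ∃ j k, n = g - 1 + j + k ∧ j ≤ l ∧
      ∑ σ : Equiv.Perm (Fin n), t ^ gexc g l σ * q ^ gden g h σ
        = transfer q (gapPath (excWeight q t (g + l - 1)) (g - 1) j k) noOpen 0 0 := by
  refine ⟨min (max h g) (n + 1) - g, n + 1 - min (max h g) (n + 1), by omega, by omega,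
    sum_gexc_gden_eq_transfer q t hl hhgl (by omega) (fun a ha c hc => ?_) (by omega)⟩
  split_ifs with h1 <;> omega

lemma sum_gexc_gden_of_le {R : Type*} [CommRing R] (q t : R) {g l h n : ℕ} (hg : 1 ≤ g)
    (hl : 1 ≤ l) (hhgl : h ≤ g + l) (hn : n ≤ g + l - 1) :
    ∑ σ : Equiv.Perm (Fin n), t ^ gexc g l σ * q ^ gden g h σ = qfact q n := by
  by_cases hgn : g ≤ n
  · obtain ⟨j, k, hjk, hj, hsum⟩ := exists_gapPath q t hg hl hhgl hgn
    rw [hsum, ← zero_add k, transfer_gapPath_add q (excWeight q t (g + l - 1)) (g - 1) j 0 k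
      (fun m hm => ?_),
      transfer_gapPath_zero, hjk, add_assoc]
    exact if_pos (by omega)
  · rw [sum_gexc_gden_eq_transfer (n := n) (d := n) (j := 0) (k := 0) q t hl hhgl rfl
      (fun a ha c hc => by simp; omega) (by omega), transfer_gapPath_zero, add_zero]

lemma sum_gexc_gden {R : Type*} [CommRing R] (q t : R) {g l h : ℕ} (k : ℕ) (hg : 1 ≤ g)
    (hl : 1 ≤ l) (hhgl : h ≤ g + l) :
    ∑ σ : Equiv.Perm (Fin (g + l - 1 + k)), t ^ gexc g l σ * q ^ gden g h σ
      = eulerMahonian q t (g + l - 1) k (g + l - 1) 0 (g + l - 1) := by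
  obtain ⟨j, k', hjk, hj, hsum⟩ := exists_gapPath (n := g + l - 1 + k) q t hg hl hhgl (by omega)
  obtain ⟨i, rfl⟩ : ∃ i, k' = k + i := ⟨l - j, by omega⟩
  have hi : j + i = l - 1 + 1 := by omega
  have hr : g - 1 + (l - 1) + 1 = g + l - 1 := by omega
  rw [hsum, transfer_gapPath_add q (excWeight q t (g + l - 1)) (g - 1) j k i
      (fun m hm => if_pos (by omega)), hi,
    transfer_gapPath q t (excWeight q t (g + l - 1)) (g - 1) (l - 1) k
      (fun m hm => if_pos (by omega))     (fun m hm => if_neg (by omega)), hr]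

/-- The 0-based letter of `σ` at the 0-based position `k`, and `0` outside of `σ`. -/
def valAt {n : ℕ} (σ : Equiv.Perm (Fin n)) (k : ℕ) : ℕ := if h : k < n then σ ⟨k, h⟩ else 0

lemma valAt_val {n : ℕ} (σ : Equiv.Perm (Fin n)) (j : Fin n) : valAt σ j = σ j := by simp [valAt]

lemma valAt_lt {n : ℕ} (σ : Equiv.Perm (Fin n)) {k : ℕ} (hk : k < n) : valAt σ k < n := by
  rw [valAt, dif_pos hk]
  exact Fin.is_lt _

lemma valAt_insertAt_succAbove {n : ℕ} (i c : Fin (n + 1)) (τ : Equiv.Perm (Fin n)) (j : Fin n) :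
    valAt (insertAt i c τ) (i.succAbove j) = c.succAbove (τ j) := by
  rw [valAt_val, insertAt_succAbove]

lemma valAt_insertAt_last {n : ℕ} (i : Fin (n + 1)) (τ : Equiv.Perm (Fin n)) {k : ℕ} (hk : k ≤ n) :
    valAt (insertAt i (Fin.last n) τ) k
      = if k < i then valAt τ k else if k = i then n else valAt τ (k - 1) := by
  have key : ∀ j : Fin n, (if (j : ℕ) < i then (j : ℕ) else j + 1) = k →
      valAt (insertAt i (Fin.last n) τ) k = valAt τ j := by
    intro j hj
    rw [← hj, ← val_succAbove, valAt_insertAt_succAbove, valAt_val, Fin.succAbove_last,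
      Fin.val_castSucc]
  split_ifs with h1 h2
  · exact key ⟨k, by omega⟩ (by simp [h1])
  · rw [h2, valAt_val, insertAt_self, Fin.val_last]
  · refine key ⟨k - 1, by omega⟩ ?_
    rw [if_neg (by simp; omega)]
    simp
    omega

/-- The `k`-th position of `σ` (1-based, with a letter following it) is an `r`-descent. -/
abbrev IsDes {n : ℕ} (r : ℕ) (σ : Equiv.Perm (Fin n)) (k : ℕ) : Prop :=
  1 ≤ k ∧ valAt σ k + r ≤ valAt σ (k - 1)

lemma mem_rdesPairs {n r : ℕ} {σ : Equiv.Perm (Fin n)} {p : Fin n × Fin n} :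
    p ∈ rdesPairs r σ ↔ (p.2 : ℕ) = p.1 + 1 ∧ (σ p.2 : ℕ) + r ≤ σ p.1 := by
  rw [rdesPairs, mem_filter]
  simp only [mem_univ, true_and, pos1, val1]
  omega

lemma sum_rdesPairs {n : ℕ} (r : ℕ) (σ : Equiv.Perm (Fin n)) (w : ℕ → ℕ) :
    ∑ p ∈ rdesPairs r σ, w (pos1 p.1) = ∑ j : Fin n, if IsDes r σ j then w j else 0 := by
  rw [← sum_filter]
  refine sum_bij (fun p _ => p.2) (fun p hp => ?_) (fun p hp p' hp' h => ?_) (fun j hj => ?_)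
    (fun p hp => ?_)
  · rw [mem_rdesPairs] at hp
    rw [mem_filter]
    refine ⟨mem_univ _, by omega, ?_⟩
    rw [valAt_val, show (p.2 : ℕ) - 1 = p.1 by omega, valAt_val]
    omega
  · rw [mem_rdesPairs] at hp hp'
    refine Prod.ext (Fin.ext ?_) h
    have := congrArg Fin.val h
    omega
  · rw [mem_filter] at hj
    obtain ⟨-, h1, h2⟩ := hj
    have hlt : (j : ℕ) - 1 < n := by omega
    rw [valAt_val, valAt, dif_pos hlt] at h2
    exact ⟨(⟨j - 1, hlt⟩, j), mem_rdesPairs.2 ⟨by simp; omega, h2⟩, rfl⟩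
  · rw [mem_rdesPairs] at hp
    rw [pos1, hp.1]

lemma rdes_eq_sum {n : ℕ} (r : ℕ) (σ : Equiv.Perm (Fin n)) :
    rdes r σ = ∑ j : Fin n, if IsDes r σ j then 1 else 0 := by
  rw [rdes, card_eq_sum_ones, sum_rdesPairs r σ (fun _ => 1)]

/-- Inserting the largest letter in front of the `k`-th position (0-based) does not change the
number of `r`-descents. -/
abbrev Keeps {n : ℕ} (r : ℕ) (τ : Equiv.Perm (Fin n)) (k : ℕ) : Prop :=
  IsDes r τ k ∨ n < valAt τ k + r

/-- The number of indices at least `i` and less than `n` satisfying `K`. -/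
def countFrom (K : ℕ → Prop) [DecidablePred K] (n i : ℕ) : ℕ :=
  ∑ j ∈ range n, if i ≤ j ∧ K j then 1 else 0

lemma isDes_insertAt_last {n : ℕ} (r : ℕ) (i : Fin (n + 1)) (τ : Equiv.Perm (Fin n))
    (j : Fin n) :
    IsDes r (insertAt i (Fin.last n) τ) (i.succAbove j)
      ↔ IsDes r τ j ∨ ((j : ℕ) = i ∧ ¬ Keeps r τ j) := by
  have hj := j.2
  have hi := i.2
  have h1 := valAt_lt τ (k := j - 1) (by omega)
  simp only [Keeps, IsDes, val_succAbove]
  split_ifs with h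
  · rw [valAt_insertAt_last i τ (by omega), valAt_insertAt_last i τ (by omega), if_pos h]
    by_cases h0 : (j : ℕ) = 0
    · omega
    · rw [if_pos (by omega)]
      omega
  · rw [valAt_insertAt_last i τ (by omega), valAt_insertAt_last i τ (by omega), if_neg (by omega),
      if_neg (by omega), if_neg (by omega), add_tsub_cancel_right]
    split_ifs with h2
    · omega
    · omega

lemma not_isDes_insertAt_last {n r : ℕ} (hr : 1 ≤ r) (i : Fin (n + 1)) (τ : Equiv.Perm (Fin n)) :
    ¬ IsDes r (insertAt i (Fin.last n) τ) i := by
  have hi := i.2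
  rintro ⟨h1, h2⟩
  rw [valAt_insertAt_last i τ (by omega), if_neg (by omega), if_pos rfl] at h2
  have := valAt_lt (insertAt i (Fin.last n) τ) (k := i - 1) (by omega)
  omega

lemma sum_fin_ite_eq (n i : ℕ) (P : ℕ → Prop) [DecidablePred P] (c : ℕ → ℕ) :
    (∑ j : Fin n, if (j : ℕ) = i ∧ P j then c j else 0) = if i < n ∧ P i then c i else 0 := by
  rw [Fin.sum_univ_eq_sum_range (fun j => if j = i ∧ P j then c j else 0)]
  simp only [ite_and, sum_ite_eq', mem_range]

lemma rdes_insertAt_last {n r : ℕ} (hr : 1 ≤ r) (i : Fin (n + 1)) (τ : Equiv.Perm (Fin n)) :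
    rdes r (insertAt i (Fin.last n) τ)
      = rdes r τ + if (i : ℕ) < n ∧ ¬ Keeps r τ i then 1 else 0 := by
  rw [rdes_eq_sum, rdes_eq_sum, ← sum_fin_ite_eq n i (fun j => ¬ Keeps r τ j) (fun _ => 1),
    Fin.sum_univ_succAbove _ i, if_neg (not_isDes_insertAt_last hr i τ), zero_add,
    ← sum_add_distrib]
  refine sum_congr rfl fun j _ => ?_
  simp only [isDes_insertAt_last r]
  by_cases h1 : IsDes r τ j
  · simp [h1]
  · simp [h1]

lemma sum_isDes_insertAt_last {n r : ℕ} (hr : 1 ≤ r) (i : Fin (n + 1)) (τ : Equiv.Perm (Fin n)) :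
    (∑ j : Fin (n + 1), if IsDes r (insertAt i (Fin.last n) τ) j then (j : ℕ) else 0)
      = (∑ j : Fin n, if IsDes r τ j then (j : ℕ) else 0)
        + (∑ j : Fin n, if (i : ℕ) ≤ j ∧ IsDes r τ j then 1 else 0)
        + if (i : ℕ) < n ∧ ¬ Keeps r τ i then (i : ℕ) + 1 else 0 := by
  rw [← sum_fin_ite_eq n i (fun j => ¬ Keeps r τ j) (fun j => j + 1),
    Fin.sum_univ_succAbove _ i, if_neg (not_isDes_insertAt_last hr i τ), zero_add,
    ← sum_add_distrib, ← sum_add_distrib]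
  refine sum_congr rfl fun j _ => ?_
  simp only [isDes_insertAt_last r]
  rw [val_succAbove]
  by_cases h1 : IsDes r τ j
  · have h2 : Keeps r τ j := Or.inl h1
    simp only [h2, not_true_eq_false, and_false, or_false, if_false]
    split_ifs <;> omega
  · simp only [h1, false_or, if_false, and_false, zero_add]
    by_cases h3 : (j : ℕ) = i
    · simp [h3]
    · simp [h3]

/-- The pairs of letters contributing to `rmaj`. -/
abbrev closeInv {n : ℕ} (r : ℕ) (σ : Equiv.Perm (Fin n)) : ℕ :=
  (univ.filter fun p : Fin n × Fin n =>
      p.1 < p.2 ∧ val1 σ p.2 < val1 σ p.1 ∧ val1 σ p.1 < val1 σ p.2 + r).card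

lemma closeInv_insertAt_last {n : ℕ} (r : ℕ) (i : Fin (n + 1)) (τ : Equiv.Perm (Fin n)) :
    closeInv r (insertAt i (Fin.last n) τ)
      = closeInv r τ + ∑ j : Fin n, if (i : ℕ) ≤ j ∧ n < valAt τ j + r then 1 else 0 := by
  unfold closeInv
  rw [card_pairs_succAbove i (fun a b => a < b ∧ val1 (insertAt i (Fin.last n) τ) b
    < val1 (insertAt i (Fin.last n) τ) a ∧ val1 (insertAt i (Fin.last n) τ) a
    < val1 (insertAt i (Fin.last n) τ) b + r) (by simp), ← card_filter]
  have h0 : (univ.filter fun j : Fin n => i.succAbove j < i ∧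
      val1 (insertAt i (Fin.last n) τ) i < val1 (insertAt i (Fin.last n) τ) (i.succAbove j) ∧
      val1 (insertAt i (Fin.last n) τ) (i.succAbove j)
        < val1 (insertAt i (Fin.last n) τ) i + r) = ∅ := by
    refine filter_false_of_mem fun j _ h => ?_
    have := h.2.1
    simp only [val1, insertAt_self, insertAt_succAbove, Fin.succAbove_last, Fin.val_castSucc,
      Fin.val_last] at this
    omega
  rw [h0, card_empty, add_zero]
  congr 1
  · congr 1
    ext p
    simp [val1, insertAt_succAbove]
  · congr 1
    ext j
    rw [mem_filter, mem_filter]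
    simp only [mem_univ, true_and, val1, insertAt_self, insertAt_succAbove, Fin.succAbove_last,
      Fin.val_castSucc, Fin.val_last, valAt_val, Fin.lt_def, val_succAbove]
    have := (τ j).2
    split_ifs <;> omega

lemma rmaj_eq_sum {n : ℕ} (r : ℕ) (σ : Equiv.Perm (Fin n)) :
    rmaj r σ = (∑ j : Fin n, if IsDes r σ j then (j : ℕ) else 0) + closeInv r σ := by
  rw [rmaj, ← sum_rdesPairs r σ (fun k => k)]

lemma countFrom_keeps {n : ℕ} (r : ℕ) (τ : Equiv.Perm (Fin n)) (i : ℕ) :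
    countFrom (Keeps r τ) n i
      = (∑ j : Fin n, if i ≤ j ∧ IsDes r τ j then 1 else 0)
        + ∑ j : Fin n, if i ≤ j ∧ n < valAt τ j + r then 1 else 0 := by
  rw [countFrom, ← Fin.sum_univ_eq_sum_range (fun j => if i ≤ j ∧ Keeps r τ j then 1 else 0),
    ← sum_add_distrib]
  refine sum_congr rfl fun j _ => ?_
  by_cases h1 : IsDes r τ j
  · have h2 : ¬ n < valAt τ j + r := by
      have h3 := valAt_lt τ (k := j - 1) (by omega)
      have h4 := h1.2
      omega
    simp [Keeps, h2]
  · simp [Keeps, h1]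

lemma rmaj_insertAt_last {n r : ℕ} (hr : 1 ≤ r) (i : Fin (n + 1)) (τ : Equiv.Perm (Fin n)) :
    rmaj r (insertAt i (Fin.last n) τ) = rmaj r τ + countFrom (Keeps r τ) n i
      + if (i : ℕ) < n ∧ ¬ Keeps r τ i then (i : ℕ) + 1 else 0 := by
  rw [rmaj_eq_sum, rmaj_eq_sum, sum_isDes_insertAt_last hr, closeInv_insertAt_last,
    countFrom_keeps r]
  ring

lemma countFrom_keeps_zero {n r : ℕ} (hr : 1 ≤ r) (τ : Equiv.Perm (Fin n)) :
    countFrom (Keeps r τ) n 0 = rdes r τ + min n (r - 1) := by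
  have h : (∑ j : Fin n, if n < valAt τ j + r then 1 else 0) = min n (r - 1) := by
    simp only [valAt_val]
    rw [Equiv.sum_comp τ (fun c : Fin n => if n < (c : ℕ) + r then 1 else 0),
      ← Equiv.sum_comp Fin.revPerm, ← card_filter, ← Fin.card_filter_val_lt]
    congr 1
    ext c
    rw [mem_filter, mem_filter]
    simp only [mem_univ, true_and, Fin.revPerm_apply, Fin.val_rev]
    omega
  rw [countFrom_keeps r, rdes_eq_sum]
  simp only [Nat.zero_le, true_and, h]

lemma countFrom_succ (K : ℕ → Prop) [DecidablePred K] (n i : ℕ) :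
    countFrom K (n + 1) i = countFrom K n i + if i ≤ n ∧ K n then 1 else 0 := by
  rw [countFrom, sum_range_succ, countFrom]

lemma one_sub_mul_sum_countFrom {R : Type*} [CommRing R] (q t : R) (K : ℕ → Prop)
    [DecidablePred K] (n : ℕ) :
    (1 - q) * (∑ i ∈ range n, (if K i then q ^ countFrom K n i
        else t * q ^ (countFrom K n i + (i + 1))) + 1)
      = 1 - q ^ (countFrom K n 0 + 1) + t * (q ^ (countFrom K n 0 + 1) - q ^ (n + 1)) := by
  induction n with
  | zero => simp [countFrom]
  | succ n ih =>
    have hn : countFrom K n n = 0 :=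
      sum_eq_zero fun j hj => if_neg fun h => absurd (mem_range.1 hj) (not_lt.2 h.1)
    rw [sum_range_succ]
    by_cases h : K n
    · have h1 : ∀ i ∈ range n, (if K i then q ^ countFrom K (n + 1) i
            else t * q ^ (countFrom K (n + 1) i + (i + 1)))
          = q * (if K i then q ^ countFrom K n i else t * q ^ (countFrom K n i + (i + 1))) := by
        intro i hi
        rw [countFrom_succ, if_pos (c := i ≤ n ∧ K n) ⟨(mem_range.1 hi).le, h⟩]
        split_ifs <;> ring
      rw [sum_congr rfl h1, ← mul_sum, if_pos h, countFrom_succ, countFrom_succ, hn,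
        if_pos ⟨le_rfl, h⟩, if_pos ⟨Nat.zero_le _, h⟩]
      linear_combination q * ih
    · have h1 : ∀ i, countFrom K (n + 1) i = countFrom K n i := fun i => by
        rw [countFrom_succ, if_neg (fun h' => h h'.2), add_zero]
      simp only [h1, if_neg h, hn]
      linear_combination ih

lemma one_sub_mul_sum_rdes_rmaj {R : Type*} [CommRing R] (q t : R) (n : ℕ) {r : ℕ} (hr : 1 ≤ r) :
    (1 - q) * ∑ σ : Equiv.Perm (Fin (n + 1)), t ^ rdes r σ * q ^ rmaj r σ
      = ∑ τ : Equiv.Perm (Fin n), t ^ rdes r τ * q ^ rmaj r τ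
          * (1 - t * q ^ (n + 1) - (1 - t) * q ^ (rdes r τ + min n (r - 1) + 1)) := by
  rw [sum_perm_insertAt_position (Fin.last n), sum_comm, mul_sum]
  refine sum_congr rfl fun τ _ => ?_
  have h1 := one_sub_mul_sum_countFrom q t (Keeps r τ) n
  have h2 : ∑ i : Fin (n + 1), t ^ rdes r (insertAt i (Fin.last n) τ)
        * q ^ rmaj r (insertAt i (Fin.last n) τ)
      = t ^ rdes r τ * q ^ rmaj r τ * (∑ i ∈ range n, (if Keeps r τ i
          then q ^ countFrom (Keeps r τ) n i
          else t * q ^ (countFrom (Keeps r τ) n i + (i + 1))) + 1) := by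
    have h3 : countFrom (Keeps r τ) n n = 0 :=
      sum_eq_zero fun j hj => if_neg fun h => absurd (mem_range.1 hj) (not_lt.2 h.1)
    simp only [rdes_insertAt_last hr, rmaj_insertAt_last hr]
    rw [Fin.sum_univ_castSucc, mul_add, mul_sum, ← Fin.sum_univ_eq_sum_range (fun i =>
      t ^ rdes r τ * q ^ rmaj r τ * if Keeps r τ i then q ^ countFrom (Keeps r τ) n i
          else t * q ^ (countFrom (Keeps r τ) n i + (i + 1)))]
    congr 1
    · refine sum_congr rfl fun i _ => ?_
      rw [Fin.val_castSucc]
      by_cases h : Keeps r τ i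
      · rw [if_neg (fun h' => h'.2 h), if_neg (fun h' => h'.2 h), if_pos h]
        ring
      · rw [if_pos ⟨i.2, h⟩, if_pos ⟨i.2, h⟩, if_neg h]
        ring
    · simp [h3]
  rw [h2, ← countFrom_keeps_zero hr]
  linear_combination t ^ rdes r τ * q ^ rmaj r τ * h1

lemma one_sub_mul_sum_rdes_rmaj_of_le {R : Type*} [CommRing R] (q t : R) {n r : ℕ}
    (hn : n + 1 ≤ r) :
    (1 - q) * ∑ σ : Equiv.Perm (Fin (n + 1)), t ^ rdes r σ * q ^ rmaj r σ
      = (1 - q ^ (n + 1)) * ∑ τ : Equiv.Perm (Fin n), t ^ rdes r τ * q ^ rmaj r τ := by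
  rw [one_sub_mul_sum_rdes_rmaj q t n (by omega), mul_sum]
  refine sum_congr rfl fun τ _ => ?_
  have h : rdes r τ = 0 := by
    rw [rdes, card_eq_zero, eq_empty_iff_forall_notMem]
    intro p hp
    have := (mem_rdesPairs.1 hp).2
    omega
  rw [h, min_eq_left (by omega)]
  ring

lemma one_sub_mul_sum_rdes_rmaj_of_ge {R : Type*} [CommRing R] (q t : R) {n r : ℕ} (hr : 1 ≤ r)
    (hn : r ≤ n + 1) :
    (1 - q) * ∑ σ : Equiv.Perm (Fin (n + 1)), t ^ rdes r σ * q ^ rmaj r σ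
      = (1 - t * q ^ (n + 1)) * ∑ τ : Equiv.Perm (Fin n), t ^ rdes r τ * q ^ rmaj r τ
        - q ^ r * (1 - t) * ∑ τ : Equiv.Perm (Fin n), (t * q) ^ rdes r τ * q ^ rmaj r τ := by
  rw [one_sub_mul_sum_rdes_rmaj q t n hr, mul_sum, mul_sum, ← sum_sub_distrib]
  refine sum_congr rfl fun τ _ => ?_
  rw [min_eq_right (by omega), show rdes r τ + (r - 1) + 1 = rdes r τ + r by omega]
  ring

lemma sum_rdes_rmaj_of_le {R : Type*} [CommRing R] [IsDomain R] {q : R} (hq : q ≠ 1) (t : R)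
    {n r : ℕ} (hn : n ≤ r) :
    ∑ σ : Equiv.Perm (Fin n), t ^ rdes r σ * q ^ rmaj r σ = qfact q n := by
  induction n with
  | zero => simp [qfact, rdes_eq_sum, rmaj_eq_sum, closeInv]
  | succ n ih =>
    refine mul_left_cancel₀ (sub_ne_zero.2 hq.symm) ?_
    rw [one_sub_mul_sum_rdes_rmaj_of_le q t hn, ih (by omega), qfact, ← mul_assoc,
      one_sub_mul_qint]

lemma sum_rdes_rmaj {R : Type*} [CommRing R] [IsDomain R] {q : R} (hq : q ≠ 1) (t : R)
    {r : ℕ} (hr : 1 ≤ r) (k : ℕ) :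
    ∑ σ : Equiv.Perm (Fin (r + k)), t ^ rdes r σ * q ^ rmaj r σ
      = eulerMahonian q t r k r 0 r := by
  induction k generalizing t with
  | zero => simp [eulerMahonian, noOpen, sum_rdes_rmaj_of_le hq t le_rfl]
  | succ k ih =>
    obtain ⟨r, rfl⟩ := Nat.exists_eq_add_of_le' hr
    refine mul_left_cancel₀ (sub_ne_zero.2 hq.symm) ?_
    rw [eulerMahonian_succ, ← add_assoc, one_sub_mul_sum_rdes_rmaj_of_ge q t hr (by omega), ih, ih,
      add_right_comm (r + 1) 1 k]

lemma sum_gexc_gden_eq_sum_rdes_rmaj {R : Type*} [CommRing R] [IsDomain R] {q : R} (hq : q ≠ 1)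
    (t : R) {g l h : ℕ} (n : ℕ) (hg : 1 ≤ g) (hl : 1 ≤ l) (hhgl : h ≤ g + l) :
    ∑ σ : Equiv.Perm (Fin n), t ^ gexc g l σ * q ^ gden g h σ
      = ∑ σ : Equiv.Perm (Fin n), t ^ rdes (g + l - 1) σ * q ^ rmaj (g + l - 1) σ := by
  rcases le_total n (g + l - 1) with hn | hn
  · rw [sum_gexc_gden_of_le q t hg hl hhgl hn, sum_rdes_rmaj_of_le hq t hn]
  · obtain ⟨k, rfl⟩ := Nat.exists_eq_add_of_le hn
    rw [sum_gexc_gden q t k hg hl hhgl, sum_rdes_rmaj hq t (by omega)]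

open Polynomial in
lemma coeff_coeff_sum_X_pow {ι : Type*} (s : Finset ι) (u v : ι → ℕ) (a b : ℕ) :
    ((∑ i ∈ s, (X : ℤ[X][X]) ^ u i * C X ^ v i).coeff a).coeff b
      = ((s.filter fun i => u i = a ∧ v i = b).card : ℤ) := by
  rw [finsetSum_coeff, finsetSum_coeff, card_filter, Nat.cast_sum]
  refine sum_congr rfl fun i _ => ?_
  rw [← C_pow, coeff_mul_C, coeff_X_pow]
  by_cases h : a = u i
  · simp [h, coeff_X_pow, eq_comm]
  · simp [h, Ne.symm h]

lemma C_X_ne_one : Polynomial.C (Polynomial.X : Polynomial ℤ) ≠ 1 := by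
  rw [← Polynomial.C_1, Polynomial.C_injective.ne_iff]
  intro h
  simpa using congrArg (Polynomial.eval 0) h

/-- Theorem 1.4: for `1 ≤ h ≤ g + ℓ`, the pair `(g exc_ℓ, g den_h)` is
`(g+ℓ−1)`-Euler–Mahonian. -/
theorem gexc_gden_is_euler_mahonian (g l h n : ℕ) (hg : 1 ≤ g) (hl : 1 ≤ l) (hh : 1 ≤ h)
    (hhgl : h ≤ g + l) (hn : 1 ≤ n) (a b : ℕ) :
    ((univ : Finset (Equiv.Perm (Fin n))).filter fun σ =>
        gexc g l σ = a ∧ gden g h σ = b).card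
      = ((univ : Finset (Equiv.Perm (Fin n))).filter fun σ =>
          rdes (g + l - 1) σ = a ∧ rmaj (g + l - 1) σ = b).card := by
  have h := sum_gexc_gden_eq_sum_rdes_rmaj (R := Polynomial (Polynomial ℤ))
    C_X_ne_one
    Polynomial.X (h := h) n hg hl hhgl
  have h' := congrArg (fun p => (p.coeff a).coeff b) h
  simp only [coeff_coeff_sum_X_pow] at h'
  exact_mod_cast h'

end PaperStmt
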